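/- arXiv:0906.0841 — 3 statements merged into one kernel-verified Lean document; each statement's English description precedes it below -/
import Mathlib

section
/- Let k be a positive integer, let l and d be positive divisors of k, and let ζ ∈ ℂ be a primitive d-th root of unity. Then Σ_{r = 0}^{k-1, gcd(r,k) = l} ζ^r = μ(d / gcd(d,l)) · φ(k/l) / φ(d / gcd(d,l)), where the right-hand side is viewed as a complex (in fact rational) number. -/
/-- Summing a function over a finite group after pulling it back along a surjective homomorphism. -/
theorem MonoidHom.card_mul_sum_comp_of_surjective {G H R : Type*} [Group G] [Group H] [Fintype G]
    [Fintype H] [CommSemiring R] (π : G →* H) (hπ : Function.Surjective π) (f : H → R) :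
    (Fintype.card H : R) * ∑ g, f (π g) = (Fintype.card G : R) * ∑ h, f h := by
  have translate (h : H) : ∑ g, f (π g * h) = ∑ g, f (π g) := by
    obtain ⟨v, rfl⟩ := hπ h
    simp_rw [← map_mul]
    exact Equiv.sum_comp (Equiv.mulRight v) fun g => f (π g)
  calc (Fintype.card H : R) * ∑ g, f (π g) = ∑ h, ∑ g, f (π g * h) := by
        simp [translate]
    _ = ∑ g, ∑ h, f (π g * h) := Finset.sum_comm
    _ = ∑ _g : G, ∑ h, f h :=
        Finset.sum_congr rfl fun g _ => Equiv.sum_comp (Equiv.mulLeft (π g)) f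
    _ = (Fintype.card G : R) * ∑ h, f h := by simp

theorem ZMod.sum_units_val {M : Type*} [AddCommMonoid M] (n : ℕ) [NeZero n] (f : ℕ → M) :
    ∑ u : (ZMod n)ˣ, f (u : ZMod n).val = ∑ r ∈ Finset.range n with r.Coprime n, f r := by
  refine Finset.sum_bij (fun u _ => (u : ZMod n).val) ?_ ?_ ?_ fun _ _ => rfl
  · intro u _
    simpa using ⟨ZMod.val_lt _, ZMod.val_coe_unit_coprime u⟩
  · intro u _ v _ h
    exact Units.ext (ZMod.val_injective n h)
  · intro r hr
    rw [Finset.mem_filter, Finset.mem_range] at hr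
    exact ⟨ZMod.unitOfCoprime r hr.2, Finset.mem_univ _, by
      rw [ZMod.coe_unitOfCoprime, ZMod.val_cast_of_lt hr.1]⟩

namespace IsPrimitiveRoot

variable {R : Type*} [CommRing R] [IsDomain R]

theorem sum_nthRootsFinset {n : ℕ} {ζ : R} (hζ : IsPrimitiveRoot ζ n) (hn : 0 < n) :
    ∑ x ∈ Polynomial.nthRootsFinset n (1 : R), x = if n = 1 then 1 else 0 := by
  have : NeZero n := ⟨hn.ne'⟩
  have h : ∑ x ∈ Polynomial.nthRootsFinset n (1 : R), x = ∑ i ∈ Finset.range n, ζ ^ i := by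
    symm
    refine Finset.sum_bij (fun i _ => ζ ^ i) ?_ ?_ ?_ fun _ _ => rfl
    · intro i _
      rw [Polynomial.mem_nthRootsFinset hn, pow_right_comm, hζ.pow_eq_one, one_pow]
    · intro i hi j hj h
      exact hζ.pow_inj (Finset.mem_range.1 hi) (Finset.mem_range.1 hj) h
    · intro x hx
      obtain ⟨i, hi, rfl⟩ := hζ.eq_pow_of_pow_eq_one ((Polynomial.mem_nthRootsFinset hn _).1 hx)
      exact ⟨i, Finset.mem_range.2 hi, rfl⟩
  rw [h]
  split_ifs with h1
  · simp [h1]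
  · exact hζ.geom_sum_eq_zero (by omega)

theorem sum_primitiveRoots {n : ℕ} {ζ : R} (hζ : IsPrimitiveRoot ζ n) (hn : 0 < n) :
    ∑ x ∈ primitiveRoots n R, x = ((ArithmeticFunction.moebius n : ℤ) : R) := by
  classical
  have key := (ArithmeticFunction.sum_eq_iff_sum_mul_moebius_eq_on
    (f := fun m => ∑ x ∈ primitiveRoots m R, x) (g := fun m => if m = 1 then (1 : R) else 0)
    {m | m ∣ n} (fun _ _ => dvd_trans)).1 ?_ n hn dvd_rfl
  · rw [← key, Finset.sum_eq_single (n, 1)]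
    · simp
    · rintro ⟨a, b⟩ hab hne
      have hb : b ≠ 1 := by
        rintro rfl
        simp_all
      simp [hb]
    · simp [hn.ne']
  · rintro m hm ⟨c, rfl⟩
    rw [← (hζ.pow hn (mul_comm m c)).sum_nthRootsFinset hm,
      nthRoots_one_eq_biUnion_primitiveRoots, Finset.sum_biUnion]
    exact fun _ _ _ _ h => IsPrimitiveRoot.disjoint h

theorem sum_pow_coprime {n : ℕ} {ζ : R} (hζ : IsPrimitiveRoot ζ n) (hn : 0 < n) :
    ∑ r ∈ Finset.range n with r.Coprime n, ζ ^ r =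
      ((ArithmeticFunction.moebius n : ℤ) : R) := by
  have : NeZero n := ⟨hn.ne'⟩
  rw [← hζ.sum_primitiveRoots hn]
  refine Finset.sum_bij (fun i _ => ζ ^ i) ?_ ?_ ?_ fun _ _ => rfl
  · intro i hi
    exact (mem_primitiveRoots hn).2 (hζ.pow_of_coprime i (Finset.mem_filter.1 hi).2)
  · intro i hi j hj h
    simp only [Finset.mem_filter, Finset.mem_range] at hi hj
    exact hζ.pow_inj hi.1 hj.1 h
  · intro x hx
    obtain ⟨i, hi, hc, rfl⟩ := hζ.isPrimitiveRoot_iff.1 ((mem_primitiveRoots hn).1 hx)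
    exact ⟨i, by simpa using ⟨hi, hc⟩, rfl⟩

theorem totient_mul_sum_pow_coprime {m n : ℕ} {ζ : R} (hζ : IsPrimitiveRoot ζ n) (hm : 0 < m)
    (hnm : n ∣ m) :
    (n.totient : R) * ∑ r ∈ Finset.range m with r.Coprime m, ζ ^ r =
      (m.totient : R) * ((ArithmeticFunction.moebius n : ℤ) : R) := by
  have hn : 0 < n := Nat.pos_of_dvd_of_pos hnm hm
  have : NeZero m := ⟨hm.ne'⟩
  have : NeZero n := ⟨hn.ne'⟩
  have h := (ZMod.unitsMap hnm).card_mul_sum_comp_of_surjective (ZMod.unitsMap_surjective hnm)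
    fun u => ζ ^ (u : ZMod n).val
  rw [ZMod.card_units_eq_totient, ZMod.card_units_eq_totient, ZMod.sum_units_val,
    hζ.sum_pow_coprime hn] at h
  rw [← h, ← ZMod.sum_units_val]
  congr 1
  refine Finset.sum_congr rfl fun u _ => ?_
  rw [ZMod.unitsMap_def, Units.coe_map, MonoidHom.coe_coe, ZMod.castHom_apply, ZMod.cast_eq_val,
    ZMod.val_natCast, hζ.eq_orderOf, pow_mod_orderOf]

end IsPrimitiveRoot

theorem Nat.sum_range_gcd_eq {M : Type*} [AddCommMonoid M] {l m : ℕ} (hl : 0 < l) (f : ℕ → M) :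
    ∑ r ∈ Finset.range (l * m) with Nat.gcd r (l * m) = l, f r =
      ∑ s ∈ Finset.range m with s.Coprime m, f (l * s) := by
  symm
  refine Finset.sum_bij (fun s _ => l * s) ?_ ?_ ?_ fun _ _ => rfl
  · intro s hs
    simp only [Finset.mem_filter, Finset.mem_range] at hs ⊢
    exact ⟨Nat.mul_lt_mul_of_pos_left hs.1 hl, by rw [Nat.gcd_mul_left, hs.2, mul_one]⟩
  · intro s _ t _ h
    exact Nat.eq_of_mul_eq_mul_left hl h
  · intro r hr
    simp only [Finset.mem_filter, Finset.mem_range] at hr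
    obtain ⟨s, rfl⟩ : l ∣ r := hr.2 ▸ Nat.gcd_dvd_left _ _
    refine ⟨s, ?_, rfl⟩
    rw [Nat.gcd_mul_left] at hr
    simp only [Finset.mem_filter, Finset.mem_range]
    exact ⟨Nat.lt_of_mul_lt_mul_left hr.1, Nat.eq_of_mul_eq_mul_left hl (by simpa using hr.2)⟩


/-- Lemma 4: if `l ∣ k`, `d ∣ k` and `ζ` is a primitive `d`-th root of unity, then
`∑_{0 ≤ r < k, gcd(r,k) = l} ζ^r = μ(d/gcd(d,l)) · φ(k/l)/φ(d/gcd(d,l))`. -/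
theorem sum_root_pow_gcd_eq_c (k l d : ℕ) (hk : 0 < k) (hl : 0 < l) (hd : 0 < d)
    (hlk : l ∣ k) (hdk : d ∣ k) (ζ : ℂ) (hζ : IsPrimitiveRoot ζ d) :
    ∑ r ∈ (Finset.range k).filter (fun r => Nat.gcd r k = l), ζ ^ r =
      ((ArithmeticFunction.moebius (d / Nat.gcd d l) : ℤ) : ℂ) *
        (Nat.totient (k / l) : ℂ) / (Nat.totient (d / Nat.gcd d l) : ℂ) := by
  obtain ⟨m, rfl⟩ := hlk
  have hm : 0 < m := Nat.pos_of_mul_pos_left hk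
  have hg : 0 < Nat.gcd d l := Nat.gcd_pos_of_pos_left _ hd
  have he : 0 < d / Nat.gcd d l := Nat.div_pos (Nat.gcd_le_left _ hd) hg
  have hζl : IsPrimitiveRoot (ζ ^ l) (d / Nat.gcd d l) := by
    rw [hζ.eq_orderOf, ← orderOf_pow' ζ hl.ne']
    exact IsPrimitiveRoot.orderOf _
  have hem : d / Nat.gcd d l ∣ m :=
    (Nat.coprime_div_gcd_div_gcd hg).dvd_of_dvd_mul_left <| by
      rw [Nat.div_mul_right_comm (Nat.gcd_dvd_right d l)]
      exact Nat.div_dvd_div (Nat.gcd_dvd_left d l) hdk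
  rw [Nat.sum_range_gcd_eq hl, Nat.mul_div_cancel_left m hl,
    eq_div_iff (Nat.cast_ne_zero.2 (Nat.totient_pos.2 he).ne'), mul_comm, mul_comm (Int.cast _)]
  simp_rw [pow_mul]
  exact hζl.totient_mul_sum_pow_coprime hm hem
end

section
/- Let k be a positive integer, let l and d be positive divisors of k, and let ζ ∈ ℂ be a primitive d-th root of unity. Then for every primitive (d / gcd(d,l))-th root of unity ξ ∈ ℂ, the number of integers r with 0 ≤ r < k, gcd(r,k) = l, and ζ^r = ξ equals φ(k/l) / φ(d / gcd(d,l)). In particular φ(d / gcd(d,l)) divides φ(k/l). -/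
/-- Every fiber of the reduction map `(ZMod n)ˣ → (ZMod m)ˣ` has `φ n / φ m` elements. -/
theorem ZMod.card_unitsMap_fiber_mul_totient {m n : ℕ} [NeZero n] (h : m ∣ n) (a : (ZMod m)ˣ) :
    Nat.card {u : (ZMod n)ˣ // ZMod.unitsMap h u = a} * Nat.totient m = Nat.totient n := by
  have : NeZero m := ⟨fun h0 => NeZero.ne n (Nat.eq_zero_of_zero_dvd (h0 ▸ h))⟩
  have hs := ZMod.unitsMap_surjective h
  have hfiber : Nat.card {u : (ZMod n)ˣ // ZMod.unitsMap h u = a} =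
      Nat.card (ZMod.unitsMap h).ker :=
    Nat.card_congr (MonoidHom.fiberEquivKerOfSurjective hs a)
  have hindex := (ZMod.unitsMap h).ker.card_mul_index
  rw [Subgroup.index_ker, MonoidHom.range_eq_top.mpr hs, Subgroup.card_top,
    Nat.card_eq_fintype_card (α := (ZMod n)ˣ), Nat.card_eq_fintype_card (α := (ZMod m)ˣ),
    ZMod.card_units_eq_totient, ZMod.card_units_eq_totient] at hindex
  rw [hfiber, hindex]

/-- If `ζ ^ l` is a primitive `m`-th root of unity with `m ∣ n`, the `r < l * n` with
`gcd(r, l * n) = l` and `ζ ^ r = (ζ ^ l) ^ a` are the multiples by `l` of the units mod `n`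
reducing to `a` mod `m`. -/
theorem card_gcd_eq_and_pow_eq {M : Type*} [CommMonoid M] {l m n : ℕ} [NeZero m] [NeZero n]
    (hl : 0 < l) (h : m ∣ n) {ζ : M} (hω : IsPrimitiveRoot (ζ ^ l) m) (a : (ZMod m)ˣ) :
    Nat.card {r : ℕ // r < l * n ∧ Nat.gcd r (l * n) = l ∧ ζ ^ r = (ζ ^ l) ^ (a : ZMod m).val} =
      Nat.card {u : (ZMod n)ˣ // ZMod.unitsMap h u = a} := by
  have hpow (s : ℕ) : ζ ^ (l * s) = (ζ ^ l) ^ (a : ZMod m).val ↔ (s : ZMod m) = a := by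
    rw [pow_mul, (hω.isOfFinOrder (NeZero.ne m)).pow_eq_pow_iff_modEq, ← hω.eq_orderOf,
      ← ZMod.natCast_eq_natCast_iff, ZMod.natCast_zmod_val]
  have hmap (u : (ZMod n)ˣ) :
      ZMod.unitsMap h u = a ↔ (((u : ZMod n).val : ℕ) : ZMod m) = a := by
    rw [Units.ext_iff, ZMod.unitsMap_val, ZMod.natCast_val]
  symm
  refine Nat.card_congr (Equiv.ofBijective (fun u => ⟨l * (u.1 : ZMod n).val, ?_, ?_, ?_⟩)
    ⟨?_, ?_⟩)
  · exact Nat.mul_lt_mul_of_pos_left (ZMod.val_lt _) hl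
  · rw [Nat.gcd_mul_left, (ZMod.val_coe_unit_coprime u.1).gcd_eq_one, mul_one]
  · exact (hpow _).2 ((hmap _).1 u.2)
  · intro u v huv
    have := Nat.eq_of_mul_eq_mul_left hl (Subtype.ext_iff.1 huv)
    exact Subtype.ext (Units.ext (ZMod.val_injective n this))
  · rintro ⟨r, hr, hgcd, hζr⟩
    obtain ⟨s, rfl⟩ : l ∣ r := hgcd ▸ Nat.gcd_dvd_left r (l * n)
    have hs : s < n := Nat.lt_of_mul_lt_mul_left hr
    have hcop : s.Coprime n := by
      rw [Nat.gcd_mul_left] at hgcd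
      exact Nat.eq_of_mul_eq_mul_left hl (by rw [hgcd, mul_one])
    have hval : ((ZMod.unitOfCoprime s hcop : (ZMod n)ˣ) : ZMod n).val = s := by
      rw [ZMod.coe_unitOfCoprime, ZMod.val_natCast_of_lt hs]
    refine ⟨⟨ZMod.unitOfCoprime s hcop, (hmap _).2 ?_⟩, Subtype.ext ?_⟩
    · rw [hval]
      exact (hpow s).1 hζr
    · exact congrArg (l * ·) hval


/-- For `l ∣ k`, `d ∣ k`, `ζ` a primitive `d`-th root of unity and `ξ` any primitive
`(d/gcd(d,l))`-th root of unity, the number of `r` with `0 ≤ r < k`, `gcd(r,k) = l`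
and `ζ^r = ξ` equals `φ(k/l)/φ(d/gcd(d,l))`; in particular
`φ(d/gcd(d,l)) ∣ φ(k/l)`. -/
theorem card_pow_eq_primitive_root (k l d : ℕ) (hk : 0 < k) (hl : 0 < l) (hd : 0 < d)
    (hlk : l ∣ k) (hdk : d ∣ k) (ζ ξ : ℂ) (hζ : IsPrimitiveRoot ζ d)
    (hξ : IsPrimitiveRoot ξ (d / Nat.gcd d l)) :
    Nat.card {r : ℕ // r < k ∧ Nat.gcd r k = l ∧ ζ ^ r = ξ} =
        Nat.totient (k / l) / Nat.totient (d / Nat.gcd d l) ∧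
      Nat.totient (d / Nat.gcd d l) ∣ Nat.totient (k / l) := by
  obtain ⟨n, rfl⟩ := hlk
  have hn : 0 < n := Nat.pos_of_mul_pos_left hk
  have hm : 0 < d / Nat.gcd d l :=
    Nat.div_pos (Nat.gcd_le_left l hd) (Nat.gcd_pos_of_pos_left l hd)
  have hω : IsPrimitiveRoot (ζ ^ l) (d / Nat.gcd d l) := by
    rw [IsPrimitiveRoot.iff_orderOf, orderOf_pow' ζ hl.ne', ← hζ.eq_orderOf]
  have hmn : d / Nat.gcd d l ∣ n := by
    refine Nat.dvd_of_mul_dvd_mul_left hl ?_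
    rw [← Nat.mul_div_assoc l (Nat.gcd_dvd_left d l), mul_comm l d]
    exact Nat.lcm_dvd hdk (dvd_mul_right l n)
  rw [Nat.mul_div_cancel_left n hl]
  generalize d / Nat.gcd d l = m at *
  have : NeZero n := ⟨hn.ne'⟩
  have : NeZero m := ⟨hm.ne'⟩
  obtain ⟨i, hi, hcop, rfl⟩ := hω.isPrimitiveRoot_iff.1 hξ
  have hval : ((ZMod.unitOfCoprime i hcop : (ZMod m)ˣ) : ZMod m).val = i := by
    rw [ZMod.coe_unitOfCoprime, ZMod.val_natCast_of_lt hi]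
  have hcard := card_gcd_eq_and_pow_eq hl hmn hω (ZMod.unitOfCoprime i hcop)
  rw [hval] at hcard
  have hfiber := ZMod.card_unitsMap_fiber_mul_totient hmn (ZMod.unitOfCoprime i hcop)
  rw [← hcard] at hfiber
  exact ⟨(Nat.div_eq_of_eq_mul_left (Nat.totient_pos.2 hm) hfiber.symm).symm,
    Dvd.intro_left _ hfiber⟩
end

section
/- Let k be a positive integer, s ≥ 0, and let l_1, …, l_s be positive divisors of k. Define N(k; l_1, …, l_s) as the number of s-tuples (r_1, …, r_s) of integers with 0 ≤ r_i < k, gcd(r_i, k) = l_i for each i, and r_1 + … + r_s ≡ 0 (mod k). Then k · N(k; l_1, …, l_s) = Σ_{d ∣ k} φ(d) · Π_{i=1}^{s} c(k, l_i, d), where c(k, l, d) = μ(d / gcd(d,l)) · φ(k/l) / φ(d / gcd(d,l)) and the sum runs over all positive divisors d of k. -/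
open Finset Polynomial

/-- The power sums of the `k`-th roots of unity. -/
theorem sum_nthRootsFinset_pow {k : ℕ} (hk : 0 < k) (a : ℕ) :
    ∑ ω ∈ nthRootsFinset k (1 : ℂ), ω ^ a = if k ∣ a then (k : ℂ) else 0 := by
  have : NeZero k := ⟨hk.ne'⟩
  have hζ := Complex.isPrimitiveRoot_exp k hk.ne'
  set ζ := Complex.exp (2 * Real.pi * Complex.I / k)
  split_ifs with h
  · obtain ⟨b, rfl⟩ := h
    rw [sum_congr rfl fun (ω : ℂ) hω => show ω ^ (k * b) = 1 by
      rw [pow_mul, (mem_nthRootsFinset hk 1).1 hω, one_pow]]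
    simp [hζ.card_nthRootsFinset]
  · have hmul : ∑ ω ∈ nthRootsFinset k (1 : ℂ), (ζ * ω) ^ a =
        ∑ ω ∈ nthRootsFinset k (1 : ℂ), ω ^ a := by
      have hζ0 : ζ ≠ 0 := hζ.ne_zero hk.ne'
      refine sum_bij' (fun ω _ => ζ * ω) (fun ω _ => ζ⁻¹ * ω) ?_ ?_ ?_ ?_ ?_
      · intro ω hω
        rw [mem_nthRootsFinset hk] at hω ⊢
        rw [mul_pow, hζ.pow_eq_one, hω, one_mul]
      · intro ω hω
        rw [mem_nthRootsFinset hk] at hω ⊢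
        rw [mul_pow, inv_pow, hζ.pow_eq_one, hω, inv_one, one_mul]
      · intros; field_simp
      · intros; field_simp
      · intros; rfl
    simp_rw [mul_pow, ← mul_sum] at hmul
    have hne : ζ ^ a ≠ 1 := fun h1 => h (hζ.dvd_of_pow_eq_one a h1)
    have h0 : (ζ ^ a - 1) * ∑ ω ∈ nthRootsFinset k (1 : ℂ), ω ^ a = 0 := by
      rw [sub_mul, hmul, one_mul, sub_self]
    exact (mul_eq_zero.1 h0).resolve_left (sub_ne_zero.2 hne)

/-- A sum over the `k`-th roots of unity, grouped by their orders. -/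
theorem sum_nthRootsFinset_eq_sum_divisors (k : ℕ) (f : ℂ → ℂ) :
    ∑ ω ∈ nthRootsFinset k (1 : ℂ), f ω =
      ∑ d ∈ k.divisors, ∑ ω ∈ primitiveRoots d ℂ, f ω := by
  rw [IsPrimitiveRoot.nthRoots_one_eq_biUnion_primitiveRoots, sum_biUnion]
  exact fun _ _ _ _ h => IsPrimitiveRoot.disjoint h

theorem sum_primitiveRoots_eq_moebius {n : ℕ} (hn : 0 < n) :
    ∑ ω ∈ primitiveRoots n ℂ, ω = (ArithmeticFunction.moebius n : ℂ) := by
  have key := (ArithmeticFunction.sum_eq_iff_sum_mul_moebius_eq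
    (f := fun n => ∑ ω ∈ primitiveRoots n ℂ, ω)
    (g := fun n => if n ∣ 1 then (n : ℂ) else 0)).1 (fun n hn => by
      rw [← sum_nthRootsFinset_eq_sum_divisors n (fun ω => ω),
        ← sum_nthRootsFinset_pow hn 1]
      simp) n hn
  rw [← key, sum_eq_single (n, 1)]
  · simp
  · rintro ⟨a, b⟩ hab hne
    have hb : b ≠ 1 := by
      rintro rfl
      simp_all
    simp [hb]
  · simp [hn.ne']

theorem sum_units_zmod_eq_sum_coprime {n : ℕ} [NeZero n] (f : ℕ → ℂ) :
    ∑ u : (ZMod n)ˣ, f (u : ZMod n).val = ∑ a ∈ range n with a.Coprime n, f a := by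
  refine sum_bij (fun u _ => (u : ZMod n).val) ?_ ?_ ?_ ?_
  · intro u _
    exact mem_filter.2 ⟨mem_range.2 (ZMod.val_lt _), ZMod.val_coe_unit_coprime u⟩
  · intro u _ v _ h
    exact Units.ext (ZMod.val_injective n h)
  · intro a ha
    rw [mem_filter, mem_range] at ha
    exact ⟨ZMod.unitOfCoprime a ha.2, mem_univ _, by
      rw [ZMod.coe_unitOfCoprime, ZMod.val_natCast, Nat.mod_eq_of_lt ha.1]⟩
  · intros; rfl

theorem IsPrimitiveRoot.sum_coprime_pow_eq_moebius {m : ℕ} (hm : 0 < m) {η : ℂ}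
    (hη : IsPrimitiveRoot η m) :
    ∑ a ∈ range m with a.Coprime m, η ^ a = (ArithmeticFunction.moebius m : ℂ) := by
  have : NeZero m := ⟨hm.ne'⟩
  rw [← sum_primitiveRoots_eq_moebius hm]
  refine sum_bij (fun a _ => η ^ a) ?_ ?_ ?_ ?_
  · intro a ha
    exact (mem_primitiveRoots hm).2 (hη.pow_of_coprime a (mem_filter.1 ha).2)
  · intro a ha b hb h
    simp only [mem_filter, mem_range] at ha hb
    exact hη.pow_inj ha.1 hb.1 h
  · intro ω hω
    obtain ⟨a, ha, hc, rfl⟩ := hη.isPrimitiveRoot_iff.1 (isPrimitiveRoot_of_mem_primitiveRoots hω)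
    exact ⟨a, mem_filter.2 ⟨mem_range.2 ha, hc⟩, rfl⟩
  · intros; rfl

/-- Hölder's formula for Ramanujan sums. -/
theorem IsPrimitiveRoot.sum_coprime_pow {m n : ℕ} (hn : 0 < n) (hmn : m ∣ n) {η : ℂ}
    (hη : IsPrimitiveRoot η m) :
    ∑ a ∈ range n with a.Coprime n, η ^ a =
      (ArithmeticFunction.moebius m : ℂ) * ((n.totient / m.totient : ℕ) : ℂ) := by
  have hm : 0 < m := Nat.pos_of_dvd_of_pos hmn hn
  have : NeZero n := ⟨hn.ne'⟩
  have : NeZero m := ⟨hm.ne'⟩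
  have hsurj := ZMod.unitsMap_surjective hmn
  set c := #{u : (ZMod n)ˣ | ZMod.unitsMap hmn u = 1}
  have hc (v : (ZMod m)ˣ) : #{u : (ZMod n)ˣ | ZMod.unitsMap hmn u = v} = c :=
    MonoidHom.card_fiber_eq_of_mem_range _ (hsurj v) (hsurj 1)
  have hcard : n.totient = m.totient * c := by
    rw [← ZMod.card_units_eq_totient n, ← ZMod.card_units_eq_totient m, ← card_univ,
      card_eq_sum_card_fiberwise (t := univ) (f := ZMod.unitsMap hmn) (fun _ _ => by simp)]
    simp [hc]
  have hdiv : n.totient / m.totient = c := by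
    rw [hcard, Nat.mul_div_cancel_left _ (Nat.totient_pos.2 hm)]
  have hpow (u : (ZMod n)ˣ) :
      η ^ (u : ZMod n).val = η ^ ((ZMod.unitsMap hmn u : (ZMod m)ˣ) : ZMod m).val := by
    rw [ZMod.unitsMap_val, ZMod.cast_eq_val, ZMod.val_natCast,
      ← pow_eq_pow_mod _ hη.pow_eq_one]
  rw [hdiv, ← hη.sum_coprime_pow_eq_moebius hm, ← sum_units_zmod_eq_sum_coprime,
    ← sum_units_zmod_eq_sum_coprime, sum_congr rfl fun u _ => hpow u,
    sum_comp (fun v : (ZMod m)ˣ => η ^ (v : ZMod m).val), image_univ_of_surjective hsurj]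
  simp [hc, mul_comm, sum_mul]

theorem IsPrimitiveRoot.sum_gcd_eq_pow {k l d : ℕ} (hk : 0 < k) (hl : l ∣ k) (hd : d ∣ k) {ω : ℂ}
    (hω : IsPrimitiveRoot ω d) :
    ∑ r ∈ range k with r.gcd k = l, ω ^ r =
      (ArithmeticFunction.moebius (d / d.gcd l) : ℂ) *
        (((k / l).totient / (d / d.gcd l).totient : ℕ) : ℂ) := by
  obtain ⟨n, rfl⟩ := hl
  have hl : 0 < l := Nat.pos_of_mul_pos_right hk
  have hn : 0 < n := Nat.pos_of_mul_pos_left hk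
  rw [Nat.mul_div_cancel_left _ hl]
  have hη : IsPrimitiveRoot (ω ^ l) (d / d.gcd l) := by
    rw [IsPrimitiveRoot.iff_orderOf, orderOf_pow' _ hl.ne', ← hω.eq_orderOf]
  rw [← hη.sum_coprime_pow hn (hη.dvd_of_pow_eq_one n (by
    rw [← pow_mul, (hω.pow_eq_one_iff_dvd _).2 hd]))]
  symm
  refine sum_bij (fun a _ => l * a) ?_ ?_ ?_ ?_
  · intro a ha
    simp only [mem_filter, mem_range] at ha ⊢
    exact ⟨Nat.mul_lt_mul_of_pos_left ha.1 hl, by rw [Nat.gcd_mul_left, ha.2, mul_one]⟩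
  · intro a _ b _ h
    exact Nat.eq_of_mul_eq_mul_left hl h
  · intro r hr
    simp only [mem_filter, mem_range] at hr
    obtain ⟨a, rfl⟩ : l ∣ r := hr.2 ▸ Nat.gcd_dvd_left r (l * n)
    refine ⟨a, ?_, rfl⟩
    simp only [mem_filter, mem_range]
    refine ⟨lt_of_mul_lt_mul_left hr.1 hl.le, ?_⟩
    rw [Nat.gcd_mul_left] at hr
    exact Nat.eq_of_mul_eq_mul_left hl (by rw [hr.2, mul_one])
  · intro a _
    rw [pow_mul]

/-- Lemma 5 (Harer–Zagier count): `k · N(k; l₁,…,l_s) = ∑_{d ∣ k} φ(d) ∏ᵢ c(k, lᵢ, d)`,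
where `N(k; l₁,…,l_s)` counts tuples `(r₁,…,r_s)` with `0 ≤ rᵢ < k`, `gcd(rᵢ,k) = lᵢ`
and `r₁ + … + r_s ≡ 0 (mod k)`, and `c(k,l,d) = μ(d/gcd(d,l)) · φ(k/l)/φ(d/gcd(d,l))`. -/
theorem harer_zagier_count (k s : ℕ) (hk : 0 < k) (l : Fin s → ℕ)
    (hl : ∀ i, 0 < l i ∧ l i ∣ k) :
    (k : ℤ) *
        Nat.card {r : Fin s → ℕ //
          (∀ i, r i < k ∧ Nat.gcd (r i) k = l i) ∧ k ∣ ∑ i, r i} =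
      ∑ d ∈ k.divisors, (Nat.totient d : ℤ) *
        ∏ i, ((ArithmeticFunction.moebius (d / Nat.gcd d (l i)) : ℤ) *
          ((Nat.totient (k / l i) / Nat.totient (d / Nat.gcd d (l i)) : ℕ) : ℤ)) := by
  classical
  let t : Fin s → Finset ℕ := fun i => {r ∈ range k | r.gcd k = l i}
  have hcard : Nat.card {r : Fin s → ℕ //
      (∀ i, r i < k ∧ Nat.gcd (r i) k = l i) ∧ k ∣ ∑ i, r i} =
      #{r ∈ Fintype.piFinset t | k ∣ ∑ i, r i} := by
    rw [← Nat.card_eq_finsetCard]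
    exact Nat.card_congr (Equiv.subtypeEquivRight fun r => by simp [t])
  rw [hcard, ← Int.cast_inj (α := ℂ)]
  calc _ = ∑ r ∈ Fintype.piFinset t, ∑ ω ∈ nthRootsFinset k (1 : ℂ), ω ^ ∑ i, r i := by
        simp_rw [sum_nthRootsFinset_pow hk]
        rw [← sum_filter, sum_const, nsmul_eq_mul]
        push_cast
        ring
    _ = ∑ ω ∈ nthRootsFinset k (1 : ℂ), ∏ i, ∑ r ∈ t i, ω ^ r := by
        rw [sum_comm]
        refine sum_congr rfl fun ω _ => ?_
        simp_rw [prod_univ_sum, prod_pow_eq_pow_sum]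
    _ = _ := by
        rw [sum_nthRootsFinset_eq_sum_divisors]
        push_cast
        refine sum_congr rfl fun d hd => ?_
        rw [← Complex.card_primitiveRoots d, ← nsmul_eq_mul]
        refine sum_eq_card_nsmul fun ω hω => prod_congr rfl fun i _ => ?_
        rw [(isPrimitiveRoot_of_mem_primitiveRoots hω).sum_gcd_eq_pow hk (hl i).2
          (Nat.dvd_of_mem_divisors hd)]
        rfl
end
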